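/- Let δ ∈ ℂ with δ ≠ 0 and define F : ℝ → ℂ by F(η) = (exp(−δ·η) − 1)/δ. Then F satisfies F'''(η) − F(η)·F''(η) + (F'(η))² + 4·F'(η) = 0 for all real η if and only if δ² = −3, i.e. δ = √3·i or δ = −√3·i. -/

import Mathlib

theorem hasDerivAt_cexp_neg_mul_ofReal (δ : ℂ) (η : ℝ) :
    HasDerivAt (fun η : ℝ => Complex.exp (-δ * (η : ℂ)))
      (-δ * Complex.exp (-δ * (η : ℂ))) η := by
  have h : HasDerivAt (fun η : ℝ => -δ * (η : ℂ)) (-δ) η := by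
    simpa using (Complex.ofRealCLM.hasDerivAt (x := η)).const_mul (-δ)
  simpa [mul_comm] using h.cexp

theorem Complex.sq_eq_neg_three_iff (δ : ℂ) :
    δ ^ 2 = -3 ↔
      (δ = (Real.sqrt 3 : ℂ) * Complex.I ∨ δ = -((Real.sqrt 3 : ℂ) * Complex.I)) := by
  have h3 : ((Real.sqrt 3 : ℂ)) ^ 2 = 3 := by
    exact_mod_cast Real.sq_sqrt (show (0 : ℝ) ≤ 3 by norm_num)
  rw [← sq_eq_sq_iff_eq_or_eq_neg, mul_pow, h3, Complex.I_sq, mul_neg_one]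


/-- For `δ ≠ 0`, the ansatz `F(η) = (e^{-δη} - 1)/δ` satisfies the `κ = -2`
autonomous equation `F''' - F·F'' + (F')² + 4F' = 0` for all real `η` if and only if
`δ² = -3`, i.e. if and only if `δ = √3·i` or `δ = -√3·i`. -/
theorem stmt_10 (δ : ℂ) (hδ : δ ≠ 0) (F : ℝ → ℂ)
    (hF : F = fun η : ℝ => (Complex.exp (-δ * (η : ℂ)) - 1) / δ) :
    ((∀ η : ℝ,
      iteratedDeriv 3 F η - F η * iteratedDeriv 2 F η + (deriv F η) ^ 2
        + 4 * deriv F η = 0) ↔ δ ^ 2 = -3) ∧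
    (δ ^ 2 = -3 ↔
      (δ = (Real.sqrt 3 : ℂ) * Complex.I ∨ δ = -((Real.sqrt 3 : ℂ) * Complex.I))) := by
  refine ⟨?_, Complex.sq_eq_neg_three_iff δ⟩
  have h1 : deriv F = fun η : ℝ => -Complex.exp (-δ * (η : ℂ)) := by
    funext η
    rw [hF, (((hasDerivAt_cexp_neg_mul_ofReal δ η).sub_const 1).div_const δ).deriv]
    field_simp
  have h2 : iteratedDeriv 2 F = fun η : ℝ => δ * Complex.exp (-δ * (η : ℂ)) := by
    funext η
    rw [iteratedDeriv_succ, iteratedDeriv_one, h1,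
      (hasDerivAt_cexp_neg_mul_ofReal δ η).fun_neg.deriv]
    ring
  have h3 : iteratedDeriv 3 F = fun η : ℝ => -δ ^ 2 * Complex.exp (-δ * (η : ℂ)) := by
    funext η
    rw [iteratedDeriv_succ, h2, ((hasDerivAt_cexp_neg_mul_ofReal δ η).const_mul δ).deriv]
    ring
  have residual (η : ℝ) :
      iteratedDeriv 3 F η - F η * iteratedDeriv 2 F η + (deriv F η) ^ 2 + 4 * deriv F η
        = -Complex.exp (-δ * (η : ℂ)) * (δ ^ 2 + 3) := by
    rw [h3, h2, h1, hF]
    field_simp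
    ring
  simp only [residual, mul_eq_zero, neg_eq_zero, Complex.exp_ne_zero, false_or, forall_const,
    add_eq_zero_iff_eq_neg]
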